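/- Expansion of the Klein–Gordon residue coefficients at low frceequency (Lemma 2.7): If p : [0,ν₀) → ℂ is a pole branch, then there exist ν₁ ∈ (0, ν₀] and C > 0 such that for all κ ∈ (0, ν₁): M(p(κ),κ) ≠ 0, and, setting J(κ) := −1/M(p(κ),κ), one has |J(κ) − i·ω_p/2| ≤ C·κ², |2·Re(J(κ)/p(κ)) − 1| ≤ C·κ², and |Re(J(κ)/p(κ)²)| ≤ C·κ². -/

import Mathlib

open MeasureTheory Complex

/-- The Fourier transform of the Maxwellian along a fixed direction:
`F(s) = n₀ · exp(−β s²/2)`. -/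
noncomputable def Fmax (n₀ β : ℝ) (s : ℝ) : ℝ := n₀ * Real.exp (-β * s ^ 2 / 2)

/-- The plasma dispersion function
`𝓛(z,κ) = −(w₀/κ²) ∫₀^∞ s F(s) exp(−(z/κ) s) ds` with `w₀ = ωp²/n₀`. -/
noncomputable def disp (n₀ β ωp : ℝ) (z : ℂ) (κ : ℝ) : ℂ :=
  -(((ωp ^ 2 / n₀ : ℝ) : ℂ) / (κ : ℂ) ^ 2) *
    ∫ s in Set.Ioi (0 : ℝ),
      ((s : ℝ) : ℂ) * ((Fmax n₀ β s : ℝ) : ℂ) * Complex.exp (-(z / (κ : ℂ)) * ((s : ℝ) : ℂ))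

/-- `M(z,κ) = (w₀/κ³) ∫₀^∞ s² F(s) exp(−(z/κ) s) ds`, which equals `∂_z 𝓛(z,κ)`. -/
noncomputable def dispDeriv (n₀ β ωp : ℝ) (z : ℂ) (κ : ℝ) : ℂ :=
  ((ωp ^ 2 / n₀ : ℝ) : ℂ) / (κ : ℂ) ^ 3 *
    ∫ s in Set.Ioi (0 : ℝ),
      ((s : ℝ) : ℂ) ^ 2 * ((Fmax n₀ β s : ℝ) : ℂ) * Complex.exp (-(z / (κ : ℂ)) * ((s : ℝ) : ℂ))

noncomputable def gk (β : ℝ) (ζ : ℂ) (k : ℕ) (s : ℝ) : ℂ :=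
  (s : ℂ) ^ k * Complex.exp (-(β : ℂ) / 2 * (s : ℂ) ^ 2 - ζ * s)

noncomputable def Ik (β : ℝ) (ζ : ℂ) (k : ℕ) : ℂ := ∫ s in Set.Ioi (0:ℝ), gk β ζ k s

lemma gk_norm (β : ℝ) (ζ : ℂ) (k : ℕ) (s : ℝ) :
    ‖gk β ζ k s‖ = |s| ^ k * Real.exp (-β / 2 * s ^ 2 - ζ.re * s) := by
  have h : (-(β : ℂ) / 2 * (s : ℂ) ^ 2 - ζ * s).re = -β / 2 * s ^ 2 - ζ.re * s := by
    have : (-(β : ℂ) / 2 * (s : ℂ) ^ 2) = ((-β / 2 * s ^ 2 : ℝ) : ℂ) := by push_cast; ring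
    rw [Complex.sub_re, this, Complex.ofReal_re]; simp
  rw [gk, norm_mul, norm_pow, Complex.norm_exp, h, Complex.norm_real, Real.norm_eq_abs]

lemma gk_cont (β : ℝ) (ζ : ℂ) (k : ℕ) : Continuous (gk β ζ k) := by
  unfold gk; fun_prop

lemma dom_int (b : ℝ) (hb : 0 < b) (k : ℕ) :
    Integrable (fun s : ℝ => |s| ^ k * Real.exp (-b * s ^ 2)) := by
  have h := (integrable_rpow_mul_exp_neg_mul_sq hb (s := (k:ℝ))
    (by have : (0:ℝ) ≤ k := Nat.cast_nonneg k
        linarith)).norm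
  refine h.congr (Filter.Eventually.of_forall fun s => ?_)
  simp [Real.rpow_natCast, abs_mul]

lemma gk_int (β : ℝ) (hβ : 0 < β) (ζ : ℂ) (k : ℕ) : Integrable (gk β ζ k) := by
  have h := (dom_int (β / 4) (by positivity) k).const_mul (Real.exp (ζ.re ^ 2 / β))
  refine h.mono' (gk_cont β ζ k).aestronglyMeasurable (Filter.Eventually.of_forall fun s => ?_)
  rw [gk_norm]
  have : Real.exp (-β / 2 * s ^ 2 - ζ.re * s)
      ≤ Real.exp (ζ.re ^ 2 / β) * Real.exp (-(β / 4) * s ^ 2) := by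
    rw [← Real.exp_add]
    apply Real.exp_le_exp.mpr
    have h2 : ζ.re ^ 2 / β + -(β / 4) * s ^ 2 - (-β / 2 * s ^ 2 - ζ.re * s)
       = (ζ.re + β / 2 * s) ^ 2 / β := by field_simp; ring
    have : 0 ≤ (ζ.re + β / 2 * s) ^ 2 / β := by positivity
    linarith
  calc _ ≤ |s| ^ k * (Real.exp (ζ.re ^ 2 / β) * Real.exp (-(β / 4) * s ^ 2)) := by gcongr
    _ = _ := by ring

lemma exp_deriv (β : ℝ) (ζ : ℂ) (s : ℝ) :
    HasDerivAt (fun s : ℝ => Complex.exp (-(β : ℂ) / 2 * (s : ℂ) ^ 2 - ζ * s))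
      (Complex.exp (-(β : ℂ) / 2 * (s : ℂ) ^ 2 - ζ * s) * (-(β : ℂ) * s - ζ)) s := by
  have h1 : HasDerivAt (fun s : ℝ => (s : ℂ)) 1 s := Complex.ofRealCLM.hasDerivAt
  have h2 := ((h1.pow 2).const_mul (-(β : ℂ) / 2)).sub (h1.const_mul ζ)
  refine (h2.cexp).congr_deriv ?_
  simp only [Pi.sub_apply, Pi.pow_apply]
  push_cast
  ring

lemma rec0 (β : ℝ) (hβ : 0 < β) (ζ : ℂ) : (β : ℂ) * Ik β ζ 1 + ζ * Ik β ζ 0 = 1 := by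
  have hd : ∀ x ∈ Set.Ici (0:ℝ), HasDerivAt (gk β ζ 0) (-(β : ℂ) * gk β ζ 1 x - ζ * gk β ζ 0 x) x := by
    intro x _
    have := exp_deriv β ζ x
    have e : gk β ζ 0 = (fun s : ℝ => Complex.exp (-(β : ℂ) / 2 * (s : ℂ) ^ 2 - ζ * s)) := by
      ext s; simp [gk]
    rw [e]
    convert this using 1
    simp [gk]; ring
  have hi : IntegrableOn (fun x => -(β : ℂ) * gk β ζ 1 x - ζ * gk β ζ 0 x) (Set.Ioi (0:ℝ)) :=
    (((gk_int β hβ ζ 1).const_mul _).sub ((gk_int β hβ ζ 0).const_mul _)).integrableOn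
  have ht := tendsto_zero_of_hasDerivAt_of_integrableOn_Ioi (fun x hx => hd x (Set.Ioi_subset_Ici_self hx)) hi (gk_int β hβ ζ 0).integrableOn
  have := integral_Ioi_of_hasDerivAt_of_tendsto' hd hi ht
  rw [integral_sub ((gk_int β hβ ζ 1).const_mul _).integrableOn ((gk_int β hβ ζ 0).const_mul _).integrableOn,
    integral_const_mul, integral_const_mul] at this
  simp only [Ik]
  have e : gk β ζ 0 0 = 1 := by simp [gk]
  rw [e] at this
  linear_combination -this

lemma recS (β : ℝ) (hβ : 0 < β) (ζ : ℂ) (k : ℕ) :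
    (β : ℂ) * Ik β ζ (k + 2) + ζ * Ik β ζ (k + 1) = (k + 1) * Ik β ζ k := by
  have hd : ∀ x ∈ Set.Ici (0:ℝ), HasDerivAt (gk β ζ (k + 1))
      (((k : ℂ) + 1) * gk β ζ k x - ((β : ℂ) * gk β ζ (k + 2) x + ζ * gk β ζ (k + 1) x)) x := by
    intro x _
    have h1 : HasDerivAt (fun s : ℝ => (s : ℂ)) 1 x := Complex.ofRealCLM.hasDerivAt
    have := (h1.pow (k + 1)).mul (exp_deriv β ζ x)
    refine (this.congr_deriv ?_)
    simp only [gk, Pi.pow_apply]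
    push_cast
    ring
  have i0 := ((gk_int β hβ ζ k).const_mul ((k : ℂ) + 1)).integrableOn (s := Set.Ioi 0)
  have i1 := ((gk_int β hβ ζ (k + 1)).const_mul ζ).integrableOn (s := Set.Ioi 0)
  have i2 := ((gk_int β hβ ζ (k + 2)).const_mul (β : ℂ)).integrableOn (s := Set.Ioi 0)
  have i3 : IntegrableOn (fun x => (β : ℂ) * gk β ζ (k + 2) x + ζ * gk β ζ (k + 1) x)
    (Set.Ioi (0:ℝ)) := i2.add i1
  have hi := i0.sub i3
  have ht := tendsto_zero_of_hasDerivAt_of_integrableOn_Ioi (fun x hx => hd x (Set.Ioi_subset_Ici_self hx)) hi (gk_int β hβ ζ (k + 1)).integrableOn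
  have := integral_Ioi_of_hasDerivAt_of_tendsto' hd hi ht
  rw [integral_sub i0 i3, integral_add i2 i1,
    integral_const_mul, integral_const_mul, integral_const_mul] at this
  simp only [Ik]
  have e : gk β ζ (k + 1) 0 = 0 := by simp [gk]
  rw [e] at this
  linear_combination -this

lemma Ik_bdd (β : ℝ) (hβ : 0 < β) (k : ℕ) : ∃ C > 0, ∀ ζ : ℂ, 0 ≤ ζ.re → ‖Ik β ζ k‖ ≤ C := by
  have hd := (dom_int (β / 2) (by positivity) k).integrableOn (s := Set.Ioi 0)
  refine ⟨(∫ s in Set.Ioi (0:ℝ), |s| ^ k * Real.exp (-(β / 2) * s ^ 2)) + 1, ?_, ?_⟩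
  · have : 0 ≤ ∫ s in Set.Ioi (0:ℝ), |s| ^ k * Real.exp (-(β / 2) * s ^ 2) :=
      integral_nonneg fun s => by positivity
    linarith
  · intro ζ hζ
    have : ‖Ik β ζ k‖ ≤ ∫ s in Set.Ioi (0:ℝ), |s| ^ k * Real.exp (-(β / 2) * s ^ 2) := by
      apply norm_integral_le_of_norm_le hd
      refine (ae_restrict_iff' measurableSet_Ioi).mpr (Filter.Eventually.of_forall fun s hs => ?_)
      rw [gk_norm]
      have hs' : 0 ≤ s := le_of_lt hs
      gcongr
      have := mul_nonneg hζ hs'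
      linarith
    linarith

lemma refl0 (β : ℝ) (hβ : 0 < β) (ζ : ℂ) :
    ∃ E : ℂ, Ik β ζ 1 = Ik β (-ζ) 1 - ζ * E / β ∧
      ‖E‖ = ‖((Real.pi : ℂ) / (β / 2 : ℂ)) ^ (1 / 2 : ℂ)‖ * Real.exp ((ζ ^ 2).re / (2 * β)) := by
  have hb : (β : ℂ) ≠ 0 := by exact_mod_cast hβ.ne'
  have h := integral_cexp_quadratic (b := -(β : ℂ) / 2) (by simp; linarith) (-ζ) 0
  have e1 : ∫ s : ℝ, gk β ζ 0 s = Ik β ζ 0 + Ik β (-ζ) 0 := by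
    have hi := gk_int β hβ ζ 0
    rw [← intervalIntegral.integral_Iic_add_Ioi (b := 0) hi.integrableOn hi.integrableOn, add_comm]
    congr 1
    rw [Ik, ← neg_zero, ← integral_comp_neg_Iic, neg_zero]
    congr 1
    ext s; simp [gk]
  refine ⟨Ik β ζ 0 + Ik β (-ζ) 0, ?_, ?_⟩
  · have a := rec0 β hβ ζ
    have b := rec0 β hβ (-ζ)
    field_simp
    linear_combination a - b
  · rw [← e1]
    have e2 : ∀ s, gk β ζ 0 s = Complex.exp (-(β : ℂ) / 2 * (s : ℂ) ^ 2 + -ζ * s + 0) := by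
      intro s; simp [gk]; ring_nf
    simp_rw [e2]
    rw [h, norm_mul, Complex.norm_exp]
    congr 2
    · congr 2; ring
    · have : (0 - (-ζ) ^ 2 / (4 * (-(β : ℂ) / 2))) = ζ ^ 2 / ((2 * β : ℝ) : ℂ) := by
        push_cast; field_simp; ring
      rw [this, Complex.div_ofReal_re]

lemma asymp_pos (β : ℝ) (hβ : 0 < β) : ∃ C > 0, ∀ ζ : ℂ, 0 ≤ ζ.re →
    ‖ζ ^ 6 * Ik β ζ 1 - ζ ^ 4 + 3 * β * ζ ^ 2‖ ≤ C := by
  obtain ⟨C1, hC1, h1⟩ := Ik_bdd β hβ 1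
  obtain ⟨C3, hC3, h3⟩ := Ik_bdd β hβ 3
  obtain ⟨C5, hC5, h5⟩ := Ik_bdd β hβ 5
  obtain ⟨C7, hC7, h7⟩ := Ik_bdd β hβ 7
  refine ⟨15 * β ^ 2 + 105 * β ^ 3 * C1 + 105 * β ^ 4 * C3 + 21 * β ^ 5 * C5 + β ^ 6 * C7,
    by positivity, fun ζ hζ => ?_⟩
  have r0 := rec0 β hβ ζ
  have r1 := recS β hβ ζ 0
  have r2 := recS β hβ ζ 1
  have r3 := recS β hβ ζ 2
  have r4 := recS β hβ ζ 3
  have r5 := recS β hβ ζ 4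
  have r6 := recS β hβ ζ 5
  norm_num at r1 r2 r3 r4 r5 r6
  have a1 : ζ ^ 2 * Ik β ζ 1 = 1 - 3 * β * Ik β ζ 1 + β ^ 2 * Ik β ζ 3 := by
    linear_combination r0 + ζ * r1 - β * r2
  have a3 : ζ ^ 2 * Ik β ζ 3 = 6 * Ik β ζ 1 - 7 * β * Ik β ζ 3 + β ^ 2 * Ik β ζ 5 := by
    linear_combination 3 * r2 + ζ * r3 - β * r4
  have a5 : ζ ^ 2 * Ik β ζ 5 = 20 * Ik β ζ 3 - 11 * β * Ik β ζ 5 + β ^ 2 * Ik β ζ 7 := by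
    linear_combination 5 * r4 + ζ * r5 - β * r6
  have key : ζ ^ 6 * Ik β ζ 1 - ζ ^ 4 + 3 * β * ζ ^ 2 =
      ((15 * β ^ 2 : ℝ) : ℂ) - ((105 * β ^ 3 : ℝ) : ℂ) * Ik β ζ 1 + ((105 * β ^ 4 : ℝ) : ℂ) * Ik β ζ 3
        - ((21 * β ^ 5 : ℝ) : ℂ) * Ik β ζ 5 + ((β ^ 6 : ℝ) : ℂ) * Ik β ζ 7 := by
    push_cast
    linear_combination (ζ ^ 4 - 3 * β * ζ ^ 2 + 15 * β ^ 2) * a1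
      + (β ^ 2 * ζ ^ 2 - 10 * β ^ 3) * a3 + β ^ 4 * a5
  rw [key]
  have n : ∀ (a : ℝ) (z : ℂ) (c : ℝ), 0 ≤ a → ‖z‖ ≤ c → ‖(a : ℂ) * z‖ ≤ a * c := by
    intro a z c ha hz
    rw [norm_mul, Complex.norm_real, Real.norm_of_nonneg ha]
    gcongr
  have m0 : ‖((15 * β ^ 2 : ℝ) : ℂ)‖ ≤ 15 * β ^ 2 := by
    rw [Complex.norm_real, Real.norm_of_nonneg (by positivity)]
  refine (norm_add_le _ _).trans (add_le_add ?_ (n _ _ _ (by positivity) (h7 ζ hζ)))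
  refine (norm_sub_le _ _).trans (add_le_add ?_ (n _ _ _ (by positivity) (h5 ζ hζ)))
  refine (norm_add_le _ _).trans (add_le_add ?_ (n _ _ _ (by positivity) (h3 ζ hζ)))
  refine (norm_sub_le _ _).trans (add_le_add m0 (n _ _ _ (by positivity) (h1 ζ hζ)))

lemma asymp (β : ℝ) (hβ : 0 < β) : ∃ C > 0, ∀ ζ : ℂ, 1 ≤ ‖ζ‖ → (ζ ^ 2).re ≤ -‖ζ‖ ^ 2 / 2 →
    ‖ζ ^ 6 * Ik β ζ 1 - ζ ^ 4 + 3 * β * ζ ^ 2‖ ≤ C := by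
  obtain ⟨C, hC, h⟩ := asymp_pos β hβ
  have hb : (β : ℂ) ≠ 0 := by exact_mod_cast hβ.ne'
  set S := ‖((Real.pi : ℂ) / (β / 2 : ℂ)) ^ (1 / 2 : ℂ)‖ with hS
  have hS0 : 0 ≤ S := norm_nonneg _
  refine ⟨C + S * (24 * (4 * β) ^ 4) / β, by positivity, fun ζ h1 h2 => ?_⟩
  rcases le_total 0 ζ.re with h0 | h0
  · have := h ζ h0
    have : 0 ≤ S * (24 * (4 * β) ^ 4) / β := by positivity
    linarith
  · obtain ⟨E, e1, e2⟩ := refl0 β hβ ζ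
    have hm := h (-ζ) (by simpa using h0)
    have e3 : ζ ^ 6 * Ik β ζ 1 - ζ ^ 4 + 3 * β * ζ ^ 2 =
      ((-ζ) ^ 6 * Ik β (-ζ) 1 - (-ζ) ^ 4 + 3 * β * (-ζ) ^ 2) - ζ ^ 7 * E / β := by
      rw [e1]; ring
    rw [e3]
    refine (norm_sub_le _ _).trans (add_le_add hm ?_)
    rw [norm_div, norm_mul, norm_pow, Complex.norm_real, Real.norm_of_nonneg hβ.le]
    refine div_le_div_of_nonneg_right ?_ hβ.le
    rw [e2]
    have g1 : Real.exp ((ζ ^ 2).re / (2 * β)) ≤ (Real.exp (‖ζ‖ ^ 2 / (4 * β)))⁻¹ := by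
      rw [← Real.exp_neg]
      apply Real.exp_le_exp.mpr
      calc (ζ ^ 2).re / (2 * β) ≤ (-‖ζ‖ ^ 2 / 2) / (2 * β) := by gcongr
        _ = _ := by field_simp; ring
    have g2 := Real.pow_div_factorial_le_exp (x := ‖ζ‖ ^ 2 / (4 * β)) (by positivity) 4
    have g3 : ‖ζ‖ ^ 7 ≤ ‖ζ‖ ^ 8 := pow_le_pow_right₀ h1 (by norm_num)
    have g4 : ‖ζ‖ ^ 8 ≤ 24 * (4 * β) ^ 4 * Real.exp (‖ζ‖ ^ 2 / (4 * β)) := by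
      have : ‖ζ‖ ^ 8 = 24 * (4 * β) ^ 4 * ((‖ζ‖ ^ 2 / (4 * β)) ^ 4 / (Nat.factorial 4)) := by
        simp only [Nat.factorial]; push_cast; field_simp
      rw [this]; gcongr
    calc ‖ζ‖ ^ 7 * (S * Real.exp ((ζ ^ 2).re / (2 * β)))
        ≤ (24 * (4 * β) ^ 4 * Real.exp (‖ζ‖ ^ 2 / (4 * β))) *
            (S * (Real.exp (‖ζ‖ ^ 2 / (4 * β)))⁻¹) := by
          gcongr; exact g3.trans g4
      _ = _ := by
          have := Real.exp_ne_zero (‖ζ‖ ^ 2 / (4 * β))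
          field_simp

lemma disp_eq (n₀ β ωp : ℝ) (hn : 0 < n₀) (z : ℂ) (κ : ℝ) :
    disp n₀ β ωp z κ = -((ωp : ℂ) ^ 2 / κ ^ 2) * Ik β (z / κ) 1 := by
  have hn' : (n₀ : ℂ) ≠ 0 := by exact_mod_cast hn.ne'
  have : ∀ s : ℝ, ((s : ℝ) : ℂ) * ((Fmax n₀ β s : ℝ) : ℂ) * Complex.exp (-(z / (κ : ℂ)) * ((s : ℝ) : ℂ))
      = n₀ * gk β (z / κ) 1 s := by
    intro s
    simp only [Fmax, gk]
    rw [sub_eq_add_neg, Complex.exp_add]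
    push_cast
    ring_nf
  unfold disp
  simp_rw [this]
  rw [integral_const_mul, Ik]
  push_cast
  field_simp

lemma dispDeriv_eq (n₀ β ωp : ℝ) (hn : 0 < n₀) (z : ℂ) (κ : ℝ) :
    dispDeriv n₀ β ωp z κ = ((ωp : ℂ) ^ 2 / κ ^ 3) * Ik β (z / κ) 2 := by
  have hn' : (n₀ : ℂ) ≠ 0 := by exact_mod_cast hn.ne'
  have : ∀ s : ℝ, ((s : ℝ) : ℂ) ^ 2 * ((Fmax n₀ β s : ℝ) : ℂ) * Complex.exp (-(z / (κ : ℂ)) * ((s : ℝ) : ℂ))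
      = n₀ * gk β (z / κ) 2 s := by
    intro s
    simp only [Fmax, gk]
    rw [sub_eq_add_neg, Complex.exp_add]
    push_cast
    ring_nf
  unfold dispDeriv
  simp_rw [this]
  rw [integral_const_mul, Ik]
  push_cast
  field_simp

/-- At a pole, the derivative is an explicit rational function. -/
lemma pole_facts (n₀ β ωp : ℝ) (hn : 0 < n₀) (hβ : 0 < β) (hω : 0 < ωp) (z : ℂ) (κ : ℝ)
    (hz : z ≠ 0) (hκ : 0 < κ) (hp : disp n₀ β ωp z κ = 1) :
    Ik β (z / κ) 1 = -(κ : ℂ) ^ 2 / ωp ^ 2 ∧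
    dispDeriv n₀ β ωp z κ = (z ^ 2 + ωp ^ 2 + β * κ ^ 2) / (β * κ ^ 2 * z) := by
  have hb : (β : ℂ) ≠ 0 := by exact_mod_cast hβ.ne'
  have hw : (ωp : ℂ) ≠ 0 := by exact_mod_cast hω.ne'
  have hk : (κ : ℂ) ≠ 0 := by exact_mod_cast hκ.ne'
  rw [disp_eq n₀ β ωp hn] at hp
  have h1 : Ik β (z / κ) 1 = -(κ : ℂ) ^ 2 / ωp ^ 2 := by
    field_simp at hp ⊢
    linear_combination -hp
  refine ⟨h1, ?_⟩
  rw [dispDeriv_eq n₀ β ωp hn]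
  have r0 := rec0 β hβ (z / κ)
  have r1 := recS β hβ (z / κ) 0
  norm_num at r1
  rw [h1] at r0 r1
  have h0 : Ik β (z / κ) 0 = (1 + β * κ ^ 2 / ωp ^ 2) * κ / z := by
    field_simp at r0 ⊢
    linear_combination r0
  rw [h0] at r1
  have h2 : Ik β (z / κ) 2 = ((1 + β * κ ^ 2 / ωp ^ 2) * κ / z + z / κ * (κ ^ 2 / ωp ^ 2)) / β := by
    rw [eq_div_iff hb]
    linear_combination r1
  rw [h2]
  field_simp
  ring

lemma final_alg (β ω C : ℝ) (hβ : 0 < β) (hω : 0 < ω) (hC : 0 < C) :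
    ∃ δ > (0:ℝ), ∃ K > (0:ℝ), ∀ (κ : ℝ) (p : ℂ), 0 < κ → κ < δ → ‖p - I * ω‖ ≤ ω / 4 →
      ‖p ^ 2 * (p ^ 4 + ω ^ 2 * p ^ 2 - 3 * β * ω ^ 2 * κ ^ 2)‖ ≤ C * ω ^ 2 * κ ^ 4 →
      (p ^ 2 + ω ^ 2 + β * κ ^ 2) / (β * κ ^ 2 * p) ≠ 0 ∧
      ‖-1 / ((p ^ 2 + ω ^ 2 + β * κ ^ 2) / (β * κ ^ 2 * p)) - I * ω / 2‖ ≤ K * κ ^ 2 ∧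
      |2 * ((-1 / ((p ^ 2 + ω ^ 2 + β * κ ^ 2) / (β * κ ^ 2 * p))) / p).re - 1| ≤ K * κ ^ 2 ∧
      |((-1 / ((p ^ 2 + ω ^ 2 + β * κ ^ 2) / (β * κ ^ 2 * p))) / p ^ 2).re| ≤ K * κ ^ 2 := by
  set C2 := (4 * C + 3 * β * ω ^ 2) * (4 / ω ^ 2) with hC2
  set C3 := (4 * C + 3 * β * C2) * (4 / ω ^ 2) with hC3
  have C2p : 0 < C2 := by positivity
  have C3p : 0 < C3 := by positivity
  refine ⟨min 1 (β / C3), by positivity,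
    C3 / (2 * β) * (2 * ω) + C2 / ω + C3 / β + C3 / (2 * β) * (2 / ω) + C2 / ω * (2 / ω ^ 2),
    by positivity, ?_⟩
  intro κ p hκ hκδ hp hmain
  have hκ1 : κ ≤ 1 := (hκδ.trans_le (min_le_left _ _)).le
  have hκ2 : κ ≤ β / C3 := (hκδ.trans_le (min_le_right _ _)).le
  have hκsq : κ ^ 2 ≤ κ := by nlinarith
  have hκ4 : κ ^ 4 ≤ κ ^ 2 := pow_le_pow_of_le_one hκ.le hκ1 (by norm_num)
  have hb : (β : ℂ) ≠ 0 := by exact_mod_cast hβ.ne'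
  have hk : (κ : ℂ) ≠ 0 := by exact_mod_cast hκ.ne'
  have nI : ‖I * (ω : ℂ)‖ = ω := by simp [abs_of_pos hω]
  have pl : ω / 2 ≤ ‖p‖ := by
    have := norm_sub_norm_le (I * (ω : ℂ)) (I * ω - p)
    rw [norm_sub_rev (I * (ω:ℂ)) p, nI] at this
    simp at this
    linarith
  have pu : ‖p‖ ≤ 2 * ω := by
    have := norm_sub_norm_le p (I * (ω : ℂ))
    rw [nI] at this
    linarith
  have pp : 0 < ‖p‖ := by linarith [half_pos hω]
  have p0 : p ≠ 0 := norm_pos_iff.mp pp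
  have psq : ω ^ 2 / 4 ≤ ‖p ^ 2‖ := by
    rw [norm_pow]; nlinarith
  -- division by p^2
  have divp : ∀ (z : ℂ) (c : ℝ), ‖p ^ 2 * z‖ ≤ c → ‖z‖ ≤ c * (4 / ω ^ 2) := by
    intro z c h
    rw [norm_mul] at h
    have h' : ω ^ 2 / 4 * ‖z‖ ≤ c := (mul_le_mul_of_nonneg_right psq (norm_nonneg z)).trans h
    calc ‖z‖ = (ω ^ 2 / 4 * ‖z‖) * (4 / ω ^ 2) := by field_simp
      _ ≤ _ := by gcongr
  have hT : ‖p ^ 4 + ω ^ 2 * p ^ 2 - 3 * β * ω ^ 2 * κ ^ 2‖ ≤ 4 * C * κ ^ 4 := by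
    refine (divp _ _ hmain).trans_eq ?_
    field_simp
  have hY : ‖p ^ 2 + (ω : ℂ) ^ 2‖ ≤ C2 * κ ^ 2 := by
    have : ‖p ^ 2 * (p ^ 2 + (ω : ℂ) ^ 2)‖ ≤ (4 * C + 3 * β * ω ^ 2) * κ ^ 2 := by
      have e : p ^ 2 * (p ^ 2 + (ω : ℂ) ^ 2) = (p ^ 4 + ω ^ 2 * p ^ 2 - 3 * β * ω ^ 2 * κ ^ 2)
        + ((3 * β * ω ^ 2 * κ ^ 2 : ℝ) : ℂ) := by push_cast; ring
      rw [e]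
      refine (norm_add_le _ _).trans ?_
      rw [Complex.norm_real, Real.norm_of_nonneg (by positivity)]
      have : 4 * C * κ ^ 4 ≤ 4 * C * κ ^ 2 := by gcongr
      linarith
    refine (divp _ _ this).trans_eq ?_
    rw [hC2]; ring
  have hX : ‖p ^ 2 + (ω : ℂ) ^ 2 + 3 * β * κ ^ 2‖ ≤ C3 * κ ^ 4 := by
    have : ‖p ^ 2 * (p ^ 2 + (ω : ℂ) ^ 2 + 3 * β * κ ^ 2)‖ ≤ (4 * C + 3 * β * C2) * κ ^ 4 := by
      have e : p ^ 2 * (p ^ 2 + (ω : ℂ) ^ 2 + 3 * β * κ ^ 2) =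
        (p ^ 4 + ω ^ 2 * p ^ 2 - 3 * β * ω ^ 2 * κ ^ 2)
        + ((3 * β * κ ^ 2 : ℝ) : ℂ) * (p ^ 2 + (ω : ℂ) ^ 2) := by push_cast; ring
      rw [e]
      refine (norm_add_le _ _).trans ?_
      rw [norm_mul, Complex.norm_real, Real.norm_of_nonneg (by positivity)]
      have : 3 * β * κ ^ 2 * ‖p ^ 2 + (ω : ℂ) ^ 2‖ ≤ 3 * β * κ ^ 2 * (C2 * κ ^ 2) := by gcongr
      nlinarith
    refine (divp _ _ this).trans_eq ?_
    rw [hC3]; ring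
  set D := p ^ 2 + (ω : ℂ) ^ 2 + β * κ ^ 2 with hD
  set X := p ^ 2 + (ω : ℂ) ^ 2 + 3 * β * κ ^ 2 with hXd
  have hDl : β * κ ^ 2 ≤ ‖D‖ := by
    have e : D = X - ((2 * β * κ ^ 2 : ℝ) : ℂ) := by rw [hD, hXd]; push_cast; ring
    have h1 := norm_sub_norm_le ((2 * β * κ ^ 2 : ℝ) : ℂ) X
    rw [Complex.norm_real, Real.norm_of_nonneg (by positivity), norm_sub_rev, ← e] at h1
    have h2 : C3 * κ ^ 4 ≤ β * κ ^ 2 := by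
      have : C3 * κ ≤ β := by rw [le_div_iff₀ C3p] at hκ2; linarith
      have h3 : C3 * κ ^ 2 ≤ β := (mul_le_mul_of_nonneg_left hκsq C3p.le).trans this
      calc C3 * κ ^ 4 = C3 * κ ^ 2 * κ ^ 2 := by ring
        _ ≤ _ := by gcongr
    linarith
  have hDp : 0 < ‖D‖ := lt_of_lt_of_le (by positivity) hDl
  have D0 : D ≠ 0 := norm_pos_iff.mp hDp
  set r : ℂ := -(β * κ ^ 2) / D with hr
  have hr1 : ‖r - 1 / 2‖ ≤ C3 / (2 * β) * κ ^ 2 := by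
    have e : r - 1 / 2 = -X / (2 * D) := by
      rw [hr]; field_simp; rw [hD, hXd]; ring
    rw [e, norm_div, norm_neg, norm_mul]
    simp only [Complex.norm_ofNat]
    rw [div_le_iff₀ (by positivity)]
    calc ‖X‖ ≤ C3 * κ ^ 4 := hX
      _ = C3 / (2 * β) * κ ^ 2 * (2 * (β * κ ^ 2)) := by field_simp
      _ ≤ _ := by gcongr
  have hJ : -1 / (D / (β * κ ^ 2 * p)) = r * p := by
    rw [hr]; field_simp
  have hpi : ‖p - I * ω‖ ≤ C2 / ω * κ ^ 2 := by
    have e : (p - I * ω) * (p + I * ω) = p ^ 2 + (ω : ℂ) ^ 2 := by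
      ring_nf; rw [Complex.I_sq]; ring
    have l : ω ≤ ‖p + I * ω‖ := by
      have h1 := norm_sub_norm_le (2 * (I * (ω : ℂ))) (I * ω - p)
      have e2 : 2 * (I * (ω : ℂ)) - (I * ω - p) = p + I * ω := by ring
      rw [e2, norm_mul, nI, norm_sub_rev (I * (ω:ℂ)) p] at h1
      simp only [Complex.norm_ofNat] at h1
      linarith
    have h2 : ‖p - I * ω‖ * ω ≤ C2 * κ ^ 2 := by
      calc ‖p - I * ω‖ * ω ≤ ‖p - I * ω‖ * ‖p + I * ω‖ := by gcongr
        _ = ‖p ^ 2 + (ω : ℂ) ^ 2‖ := by rw [← norm_mul, e]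
        _ ≤ _ := hY
    calc ‖p - I * ω‖ = ‖p - I * ω‖ * ω / ω := by field_simp
      _ ≤ C2 * κ ^ 2 / ω := by gcongr
      _ = _ := by ring
  have t1 : 0 ≤ C3 / (2 * β) * (2 * ω) * κ ^ 2 := by positivity
  have t2 : 0 ≤ C2 / ω * κ ^ 2 := by positivity
  have t3 : 0 ≤ C3 / β * κ ^ 2 := by positivity
  have t4 : 0 ≤ C3 / (2 * β) * (2 / ω) * κ ^ 2 := by positivity
  have t5 : 0 ≤ C2 / ω * (2 / ω ^ 2) * κ ^ 2 := by positivity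
  refine ⟨div_ne_zero D0 (by simp [hb, hk, p0]), ?_, ?_, ?_⟩
  · rw [hJ]
    have e : r * p - I * ω / 2 = (r - 1 / 2) * p + (p - I * ω) / 2 := by ring
    rw [e]
    refine (norm_add_le _ _).trans ?_
    rw [norm_mul, norm_div]
    simp only [Complex.norm_ofNat]
    have : ‖r - 1 / 2‖ * ‖p‖ ≤ C3 / (2 * β) * κ ^ 2 * (2 * ω) := by gcongr
    linarith [norm_nonneg (p - I * ω)]
  · rw [hJ, mul_div_cancel_right₀ _ p0]
    have e : 2 * r.re - 1 = 2 * (r - 1 / 2).re := by simp; ring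
    rw [e, abs_mul, abs_two]
    have := (Complex.abs_re_le_norm (r - 1 / 2)).trans hr1
    have e2 : 2 * (C3 / (2 * β) * κ ^ 2) = C3 / β * κ ^ 2 := by field_simp
    linarith
  · rw [hJ]
    have e : r * p / p ^ 2 = (r - 1 / 2) / p + ((1 / 2 : ℝ) : ℂ) * p⁻¹ := by
      push_cast; field_simp; ring
    rw [e, Complex.add_re, Complex.re_ofReal_mul]
    have q1 : |((r - 1 / 2) / p).re| ≤ C3 / (2 * β) * κ ^ 2 * (2 / ω) := by
      refine (Complex.abs_re_le_norm _).trans ?_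
      rw [norm_div, div_eq_mul_inv]
      have : ‖p‖⁻¹ ≤ 2 / ω := by
        rw [← inv_div]; exact inv_anti₀ (by positivity) pl
      gcongr
    have q2 : |(p⁻¹).re| ≤ C2 / ω * κ ^ 2 * (4 / ω ^ 2) := by
      rw [Complex.inv_re, abs_div, Complex.normSq_eq_norm_sq, ← norm_pow, abs_norm, div_eq_mul_inv]
      have a : |p.re| ≤ C2 / ω * κ ^ 2 := by
        have := Complex.abs_re_le_norm (p - I * ω)
        simp at this
        simpa using this.trans hpi
      have : ‖p ^ 2‖⁻¹ ≤ 4 / ω ^ 2 := by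
        rw [← inv_div]; exact inv_anti₀ (by positivity) psq
      gcongr
    refine (abs_add_le _ _).trans ?_
    rw [abs_mul, abs_of_pos (by norm_num : (0:ℝ) < 1 / 2)]
    have q3 : 1 / 2 * (C2 / ω * κ ^ 2 * (4 / ω ^ 2)) = C2 / ω * (2 / ω ^ 2) * κ ^ 2 := by ring
    linarith

/-- **Expansion of the Klein–Gordon residue coefficients at low frequency** (Lemma 2.7). -/
theorem klein_gordon_residue_coefficients
    (n₀ β ωp : ℝ) (hn : 0 < n₀) (hβ : 0 < β) (hω : 0 < ωp)
    (ν₀ : ℝ) (hν₀ : 0 < ν₀) (p : ℝ → ℂ)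
    (hpc : ContinuousOn p (Set.Ico 0 ν₀))
    (hp0 : p 0 = Complex.I * (ωp : ℂ))
    (hpole : ∀ κ ∈ Set.Ioo (0:ℝ) ν₀, disp n₀ β ωp (p κ) κ = 1) :
    ∃ ν₁ ∈ Set.Ioc (0:ℝ) ν₀, ∃ C > (0:ℝ), ∀ κ ∈ Set.Ioo (0:ℝ) ν₁,
      dispDeriv n₀ β ωp (p κ) κ ≠ 0 ∧
      ‖-1 / dispDeriv n₀ β ωp (p κ) κ - Complex.I * (ωp : ℂ) / 2‖ ≤ C * κ ^ 2 ∧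
      |2 * ((-1 / dispDeriv n₀ β ωp (p κ) κ) / p κ).re - 1| ≤ C * κ ^ 2 ∧
      |((-1 / dispDeriv n₀ β ωp (p κ) κ) / (p κ) ^ 2).re| ≤ C * κ ^ 2 := by
  obtain ⟨C, hC, hasy⟩ := asymp β hβ
  obtain ⟨δ, hδ, K, hK, hfin⟩ := final_alg β ωp C hβ hω hC
  have hc0 : ContinuousWithinAt p (Set.Ico 0 ν₀) 0 := hpc 0 ⟨le_rfl, hν₀⟩
  obtain ⟨η, hη, hcont⟩ := Metric.continuousWithinAt_iff.mp hc0 (ωp / 4) (by positivity)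
  refine ⟨min (min ν₀ η) (min δ (ωp / 2)), ⟨by positivity, (min_le_left _ _).trans (min_le_left _ _)⟩,
    K, hK, ?_⟩
  rintro κ ⟨hκ, hκν⟩
  simp only [lt_min_iff] at hκν
  obtain ⟨⟨k1, k2⟩, k3, k4⟩ := hκν
  have hd := hcont (x := κ) ⟨hκ.le, k1⟩ (by simpa [abs_of_pos hκ] using k2)
  rw [hp0, dist_eq_norm] at hd
  have hre := (Complex.abs_re_le_norm _).trans hd.le
  have him := (Complex.abs_im_le_norm _).trans hd.le
  simp at hre him
  rw [abs_le] at hre him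
  have pim : 3 / 4 * ωp ≤ (p κ).im := by linarith
  have p0 : p κ ≠ 0 := by
    intro h
    rw [h] at pim
    simp at pim
    linarith
  obtain ⟨f1, f2⟩ := pole_facts n₀ β ωp hn hβ hω (p κ) κ p0 hκ (hpole κ ⟨hκ, k1⟩)
  have hw : (ωp : ℂ) ≠ 0 := by exact_mod_cast hω.ne'
  have hk : (κ : ℂ) ≠ 0 := by exact_mod_cast hκ.ne'
  rw [f2]
  have nz : ‖p κ / (κ : ℂ)‖ = ‖p κ‖ / κ := by
    rw [norm_div, Complex.norm_real, Real.norm_of_nonneg hκ.le]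
  have hA := hasy (p κ / κ) (by
      rw [nz, le_div_iff₀ hκ]
      have := (le_abs_self _).trans (Complex.abs_im_le_norm (p κ))
      linarith) (by
      rw [nz, div_pow, div_pow, ← Complex.ofReal_pow, Complex.div_ofReal_re]
      have e : ((p κ) ^ 2).re ≤ -‖p κ‖ ^ 2 / 2 := by
        rw [← Complex.normSq_eq_norm_sq, Complex.normSq_apply, pow_two, Complex.mul_re]
        nlinarith
      calc ((p κ) ^ 2).re / κ ^ 2 ≤ (-‖p κ‖ ^ 2 / 2) / κ ^ 2 := by gcongr
        _ = _ := by ring)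
  rw [f1] at hA
  refine hfin κ (p κ) hκ k3 hd.le ?_
  have e : (p κ) ^ 2 * ((p κ) ^ 4 + ωp ^ 2 * (p κ) ^ 2 - 3 * β * ωp ^ 2 * κ ^ 2) =
      -(((ωp ^ 2 * κ ^ 4 : ℝ) : ℂ) * ((p κ / κ) ^ 6 * (-(κ : ℂ) ^ 2 / ωp ^ 2) - (p κ / κ) ^ 4
        + 3 * β * (p κ / κ) ^ 2)) := by
    push_cast
    field_simp
    ring
  rw [e, norm_neg, norm_mul, Complex.norm_real, Real.norm_of_nonneg (by positivity)]
  calc _ ≤ ωp ^ 2 * κ ^ 4 * C := by gcongr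
    _ = _ := by ring
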